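/- If E is a centrally orthocomplete generalized pseudoeffect algebra (COGPEA), then there exists a largest element u in the center Γ(E), Γ(E) ⊆ E[0,u], and the center Γ(E) is a complete boolean algebra. -/

import Mathlib

/- Common framework: generalized pseudoeffect algebras (GPEAs), after
   Foulis, Pulmannová, Vinceková, "The exocenter and type decompositions for
   generalized pseudoeffect algebras".
   A partial binary operation ⊕ is represented by its graph
   `R : E → E → E → Prop`, where `R a b s` means "a ⊕ b is defined and equals s". -/

universe u v

namespace GPEApaper

/-- Raw data of a partial algebra: the graph of a partial binary operation
together with a zero element. -/
structure PartialAlg (E : Type u) where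
  R : E → E → E → Prop
  zero : E

namespace PartialAlg

variable {E : Type u} (A : PartialAlg E)

/-- The axioms (GPEA1)–(GPEA5) of a generalized pseudoeffect algebra,
including the functionality (well-definedness) of the partial operation. -/
def IsGPEA : Prop :=
  -- ⊕ is a partial operation (single-valued)
  (∀ a b c d : E, A.R a b c → A.R a b d → c = d) ∧
  -- (GPEA1) associativity, both directions
  (∀ a b c ab abc : E, A.R a b ab → A.R ab c abc → ∃ bc, A.R b c bc ∧ A.R a bc abc) ∧
  (∀ a b c bc abc : E, A.R b c bc → A.R a bc abc → ∃ ab, A.R a b ab ∧ A.R ab c abc) ∧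
  -- (GPEA2) conjugacy
  (∀ a b s : E, A.R a b s → (∃ d, A.R d a s) ∧ (∃ e, A.R b e s)) ∧
  -- (GPEA3) cancellation
  (∀ a b c s : E, A.R a b s → A.R a c s → b = c) ∧
  (∀ a b c s : E, A.R b a s → A.R c a s → b = c) ∧
  -- (GPEA4) positivity
  (∀ a b : E, A.R a b A.zero → a = A.zero ∧ b = A.zero) ∧
  -- (GPEA5) zero element
  (∀ a : E, A.R a A.zero a ∧ A.R A.zero a a)

/-- a ⊕ b is defined. -/
def Defined (a b : E) : Prop := ∃ s, A.R a b s

/-- The induced partial order: a ≤ b iff a ⊕ x = b for some x. -/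
def le (a b : E) : Prop := ∃ x, A.R a x b

/-- Orthogonality: p ⊥ q iff p ⊕ q and q ⊕ p both exist and are equal. -/
def perp (a b : E) : Prop := ∃ s, A.R a b s ∧ A.R b a s

/-- b is an upper bound of the set S. -/
def IsUB (S : Set E) (b : E) : Prop := ∀ a ∈ S, A.le a b

/-- s is the supremum (least upper bound) of the set S in (E, ≤). -/
def IsSup (S : Set E) (s : E) : Prop := A.IsUB S s ∧ ∀ b, A.IsUB S b → A.le s b

/-- s is the infimum (greatest lower bound) of the set S in (E, ≤). -/
def IsInf (S : Set E) (s : E) : Prop :=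
  (∀ a ∈ S, A.le s a) ∧ ∀ b, (∀ a ∈ S, A.le b a) → A.le b s

/-- An ideal of a GPEA. -/
def IsIdeal (I : Set E) : Prop :=
  I.Nonempty ∧ (∀ a ∈ I, ∀ b, A.le b a → b ∈ I) ∧
    ∀ a ∈ I, ∀ b ∈ I, ∀ s, A.R a b s → s ∈ I

/-- E = S ⊕ S′ : S and S′ are ideals, elements of S are orthogonal to elements
of S′, and every element of E has a unique decomposition a = a₁ ⊕ a₂ with
a₁ ∈ S, a₂ ∈ S′. -/
def IsDirectSum (S S' : Set E) : Prop :=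
  A.IsIdeal S ∧ A.IsIdeal S' ∧ (∀ a ∈ S, ∀ b ∈ S', A.perp a b) ∧
    ∀ a : E, ∃! p : E × E, p.1 ∈ S ∧ p.2 ∈ S' ∧ A.R p.1 p.2 a

/-- A central ideal (direct summand). -/
def IsCentralIdeal (S : Set E) : Prop := ∃ S', A.IsDirectSum S S'

/-- A normal ideal. -/
def IsNormalIdeal (I : Set E) : Prop :=
  A.IsIdeal I ∧ ∀ a x y s : E, A.R a x s → A.R y a s → (x ∈ I ↔ y ∈ I)

/-- The axioms (EXC1)–(EXC4): π belongs to the exocenter ΓEX(E). -/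
def IsExo (π : E → E) : Prop :=
  (∀ e f s, A.R e f s → A.R (π e) (π f) (π s)) ∧
  (∀ e, π (π e) = π e) ∧
  (∀ e, A.le (π e) e) ∧
  (∀ e f, π e = e → π f = A.zero → A.perp e f)

/-- For a ≤ b, `A.rdiv a b` is the element a/b, i.e. the unique x with
a ⊕ x = b (chosen by Hilbert choice when it exists). -/
noncomputable def rdiv (a b : E) : E :=
  letI : Nonempty E := ⟨A.zero⟩
  Classical.epsilon fun x => A.R a x b

/-- For π in the exocenter, π′ e := (π e)/e. -/
noncomputable def exoCompl (π : E → E) : E → E := fun e => A.rdiv (π e) e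

/-- The order on the exocenter: ξ ≤ π iff ξ = ξ ∘ π. -/
def exoLe (_A : PartialAlg E) (ξ π : E → E) : Prop := ξ = ξ ∘ π

/-- Disjointness in the boolean algebra ΓEX(E): the meet (= composition)
of ξ and π is the zero map. -/
def exoDisjoint (ξ π : E → E) : Prop := ∀ e, ξ (π e) = A.zero

/-- The join in the boolean algebra ΓEX(E): π ∨ ξ = (π′ ∘ ξ′)′. -/
noncomputable def exoSup (π ξ : E → E) : E → E :=
  A.exoCompl (A.exoCompl π ∘ A.exoCompl ξ)

/-- σ is the least upper bound of a set S of exocenter elements,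
with respect to the order of the boolean algebra ΓEX(E). -/
def IsExoLUB (S : Set (E → E)) (σ : E → E) : Prop :=
  A.IsExo σ ∧ (∀ π ∈ S, A.exoLe π σ) ∧
    ∀ β, A.IsExo β → (∀ π ∈ S, A.exoLe π β) → A.exoLe σ β

/-- A central element (C1)–(C4). -/
def Central (c : E) : Prop :=
  (∀ a : E, ∃ a₁ a₂, A.le a₁ c ∧ A.Defined a₂ c ∧ A.R a₁ a₂ a) ∧
  (∀ a b : E, A.le a c → A.Defined b c → A.perp a b) ∧
  (∀ a b s : E, A.le a c → A.le b c → A.R a b s → A.le s c) ∧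
  (∀ a b ab : E, A.Defined a c → A.Defined b c → A.R a b ab → A.Defined ab c)

/-- `A.ListSumsTo [e₁, …, eₙ] s` : the orthosum e₁ ⊕ (e₂ ⊕ (⋯ ⊕ eₙ)) is
defined and equals s (empty orthosum is 0). -/
def ListSumsTo (A : PartialAlg E) : List E → E → Prop
  | [], s => s = A.zero
  | a :: l, s => ∃ t, A.ListSumsTo l t ∧ A.R a t s

/-- The finite subfamily indexed by F is orthogonal with orthosum s:
every enumeration of F yields the orthosum s. -/
def FinsetSumsTo {ι : Type v} (e : ι → E) (F : Finset ι) (s : E) : Prop :=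
  ∀ l : List ι, l.Nodup →
    (letI : DecidableEq ι := Classical.decEq ι; l.toFinset) = F →
    A.ListSumsTo (l.map e) s

/-- A family is orthogonal iff every finite subfamily is orthogonal
(all enumerations have a common orthosum). -/
def IsOrthogonal {ι : Type v} (e : ι → E) : Prop :=
  ∀ F : Finset ι, ∃ s, A.FinsetSumsTo e F s

/-- A family is orthosummable with orthosum s iff it is orthogonal and s is
the supremum of its finite partial orthosums. -/
def IsOrthosum {ι : Type v} (e : ι → E) (s : E) : Prop :=
  A.IsOrthogonal e ∧ A.IsSup {t | ∃ F : Finset ι, A.FinsetSumsTo e F t} s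

/-- A family (eᵢ) is ΓEX-orthogonal iff there is a pairwise disjoint family
(πᵢ) in the exocenter with πᵢ eᵢ = eᵢ for all i. -/
def GEXOrthogonal {ι : Type v} (e : ι → E) : Prop :=
  ∃ π : ι → E → E, (∀ i, A.IsExo (π i)) ∧
    (∀ i j, i ≠ j → A.exoDisjoint (π i) (π j)) ∧ ∀ i, π i (e i) = e i

/-- E is centrally orthocomplete: (CO1) every ΓEX-orthogonal family is
orthosummable, and (CO2) orthosums respect one-sided summability. -/
def IsCOGPEA : Prop :=
  (∀ {ι : Type u} (e : ι → E), A.GEXOrthogonal e → ∃ s, A.IsOrthosum e s) ∧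
  (∀ {ι : Type u} (e : ι → E) (s : E), A.GEXOrthogonal e → A.IsOrthosum e s →
    ∀ a : E, ((∀ i, A.Defined a (e i)) → A.Defined a s) ∧
             ((∀ i, A.Defined (e i) a) → A.Defined s a))

/-- γ is the exocentral cover of e: the smallest element of ΓEX(E) fixing e. -/
def IsExoCover (e : E) (γ : E → E) : Prop :=
  A.IsExo γ ∧ γ e = e ∧ ∀ π, A.IsExo π → π e = e → A.exoLe γ π

/-- The restriction of the partial algebra to a subset containing 0 (with the
operation defined whenever it is defined in E and the result lies in the subset). -/
def restrictSet (S : Set E) (h0 : A.zero ∈ S) : PartialAlg S where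
  R a b s := A.R a.1 b.1 s.1
  zero := ⟨A.zero, h0⟩

/-- The axioms (PEA1)–(PEA4) of a pseudoeffect algebra with unit `one`
(including single-valuedness of the partial operation). -/
def IsPEA (one : E) : Prop :=
  (∀ a b c d : E, A.R a b c → A.R a b d → c = d) ∧
  -- (PEA1)
  (∀ a b c ab abc : E, A.R a b ab → A.R ab c abc → ∃ bc, A.R b c bc ∧ A.R a bc abc) ∧
  (∀ a b c bc abc : E, A.R b c bc → A.R a bc abc → ∃ ab, A.R a b ab ∧ A.R ab c abc) ∧
  -- (PEA2)
  (∀ a : E, ∃! d, A.R a d one) ∧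
  (∀ a : E, ∃! e, A.R e a one) ∧
  -- (PEA3)
  (∀ a b s : E, A.R a b s → (∃ d, A.R d a s) ∧ (∃ e, A.R b e s)) ∧
  -- (PEA4)
  (∀ a s : E, A.R one a s ∨ A.R a one s → a = A.zero)

end PartialAlg

end GPEApaper

namespace GPEApaper.PartialAlg

variable {E : Type u} {A : PartialAlg E}

namespace IsGPEA

theorem unique (hA : A.IsGPEA) {a b c d : E} (h : A.R a b c) (h' : A.R a b d) : c = d :=
  hA.1 _ _ _ _ h h'

theorem assoc_right (hA : A.IsGPEA) {a b c ab abc : E} (h : A.R a b ab) (h' : A.R ab c abc) :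
    ∃ bc, A.R b c bc ∧ A.R a bc abc :=
  hA.2.1 _ _ _ _ _ h h'

theorem assoc_left (hA : A.IsGPEA) {a b c bc abc : E} (h : A.R b c bc) (h' : A.R a bc abc) :
    ∃ ab, A.R a b ab ∧ A.R ab c abc :=
  hA.2.2.1 _ _ _ _ _ h h'

theorem conj_left (hA : A.IsGPEA) {a b s : E} (h : A.R a b s) : ∃ d, A.R d a s :=
  (hA.2.2.2.1 _ _ _ h).1

theorem conj_right (hA : A.IsGPEA) {a b s : E} (h : A.R a b s) : ∃ d, A.R b d s :=
  (hA.2.2.2.1 _ _ _ h).2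

theorem cancel_left (hA : A.IsGPEA) {a b c s : E} (h : A.R a b s) (h' : A.R a c s) : b = c :=
  hA.2.2.2.2.1 _ _ _ _ h h'

theorem cancel_right (hA : A.IsGPEA) {a b c s : E} (h : A.R b a s) (h' : A.R c a s) : b = c :=
  hA.2.2.2.2.2.1 _ _ _ _ h h'

theorem positive (hA : A.IsGPEA) {a b : E} (h : A.R a b A.zero) : a = A.zero ∧ b = A.zero :=
  hA.2.2.2.2.2.2.1 _ _ h

theorem add_zero (hA : A.IsGPEA) (a : E) : A.R a A.zero a := (hA.2.2.2.2.2.2.2 a).1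

theorem zero_add (hA : A.IsGPEA) (a : E) : A.R A.zero a a := (hA.2.2.2.2.2.2.2 a).2

theorem le_refl (hA : A.IsGPEA) (a : E) : A.le a a := ⟨_, hA.add_zero a⟩

theorem zero_le (hA : A.IsGPEA) (a : E) : A.le A.zero a := ⟨_, hA.zero_add a⟩

theorem le_trans (hA : A.IsGPEA) {a b c : E} (h : A.le a b) (h' : A.le b c) : A.le a c := by
  obtain ⟨x, hx⟩ := h
  obtain ⟨y, hy⟩ := h'
  obtain ⟨z, -, hz⟩ := hA.assoc_right hx hy
  exact ⟨z, hz⟩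

theorem eq_zero_of_add_eq_self (hA : A.IsGPEA) {a x : E} (h : A.R a x a) : x = A.zero :=
  hA.cancel_left h (hA.add_zero a)

theorem eq_zero_of_add_eq_self' (hA : A.IsGPEA) {a x : E} (h : A.R x a a) : x = A.zero :=
  hA.cancel_right h (hA.zero_add a)

theorem le_antisymm (hA : A.IsGPEA) {a b : E} (h : A.le a b) (h' : A.le b a) : a = b := by
  obtain ⟨x, hx⟩ := h
  obtain ⟨y, hy⟩ := h'
  obtain ⟨z, hz, haz⟩ := hA.assoc_right hx hy
  obtain rfl := hA.eq_zero_of_add_eq_self haz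
  obtain ⟨rfl, -⟩ := hA.positive hz
  exact hA.unique (hA.add_zero a) hx

theorem le_zero (hA : A.IsGPEA) {a : E} (h : A.le a A.zero) : a = A.zero :=
  hA.le_antisymm h (hA.zero_le a)

theorem le_of_add_left (hA : A.IsGPEA) {a b s : E} (h : A.R a b s) : A.le b s :=
  hA.conj_right h

theorem exists_left (hA : A.IsGPEA) {a b : E} (h : A.le a b) : ∃ x, A.R x a b := by
  obtain ⟨x, hx⟩ := h
  exact hA.conj_left hx

theorem eq_of_add_zero (hA : A.IsGPEA) {a b : E} (h : A.R a A.zero b) : a = b :=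
  hA.unique (hA.add_zero a) h

theorem eq_of_zero_add (hA : A.IsGPEA) {a b : E} (h : A.R A.zero a b) : a = b :=
  hA.unique (hA.zero_add a) h

theorem add_mono (hA : A.IsGPEA) {a a' b b' s : E} (ha : A.le a a') (hb : A.le b b')
    (h : A.R a' b' s) : ∃ t, A.R a b t ∧ A.le t s := by
  obtain ⟨p, hp⟩ := hA.exists_left ha
  obtain ⟨q, hq⟩ := hb
  obtain ⟨r, hr, hrs⟩ := hA.assoc_right hp h
  obtain ⟨t, ht, htr⟩ := hA.assoc_left hq hr
  exact ⟨t, ht, hA.le_trans ⟨q, htr⟩ (hA.le_of_add_left hrs)⟩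

/-- If the middle summands commute, then `(a ⊕ b) ⊕ (c ⊕ d) = (a ⊕ c) ⊕ (b ⊕ d)`. -/
theorem add_add_add_comm (hA : A.IsGPEA) {a b c d ab cd s : E} (hab : A.R a b ab)
    (hcd : A.R c d cd) (hs : A.R ab cd s) (hbc : A.perp b c) :
    ∃ ac bd, A.R a c ac ∧ A.R b d bd ∧ A.R ac bd s := by
  obtain ⟨t, hbc, hcb⟩ := hbc
  obtain ⟨x, hx, hax⟩ := hA.assoc_right hab hs
  obtain ⟨y, hy, hyd⟩ := hA.assoc_left hcd hx
  obtain rfl := hA.unique hbc hy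
  obtain ⟨z, hz, hcz⟩ := hA.assoc_right hcb hyd
  obtain ⟨w, hw, hwz⟩ := hA.assoc_left hcz hax
  exact ⟨w, z, hw, hz, hwz⟩

end IsGPEA

namespace IsExo

variable {π ξ : E → E}

theorem map_add (hπ : A.IsExo π) {e f s : E} (h : A.R e f s) : A.R (π e) (π f) (π s) :=
  hπ.1 _ _ _ h

theorem idem (hπ : A.IsExo π) (e : E) : π (π e) = π e := hπ.2.1 e

theorem map_le (hπ : A.IsExo π) (e : E) : A.le (π e) e := hπ.2.2.1 e

theorem perp (hπ : A.IsExo π) {e f : E} (he : π e = e) (hf : π f = A.zero) : A.perp e f :=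
  hπ.2.2.2 _ _ he hf

theorem perp' (hπ : A.IsExo π) {e f : E} (he : π e = e) (hf : π f = A.zero) : A.perp f e := by
  obtain ⟨s, h, h'⟩ := hπ.perp he hf
  exact ⟨s, h', h⟩

theorem mono (hπ : A.IsExo π) {e f : E} (h : A.le e f) : A.le (π e) (π f) := by
  obtain ⟨x, hx⟩ := h
  exact ⟨_, hπ.map_add hx⟩

theorem map_zero (hA : A.IsGPEA) (hπ : A.IsExo π) : π A.zero = A.zero :=
  hA.le_zero (hπ.map_le _)

theorem eq_zero_of_le (hA : A.IsGPEA) (hπ : A.IsExo π) {e f : E} (h : A.le e f)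
    (hf : π f = A.zero) : π e = A.zero :=
  hA.le_zero (hf ▸ hπ.mono h)

theorem map_compl (hA : A.IsGPEA) (hπ : A.IsExo π) {e x : E} (h : A.R (π e) x e) :
    π x = A.zero := by
  have := hπ.map_add h
  rw [hπ.idem] at this
  exact hA.eq_zero_of_add_eq_self this

theorem fix_of_le (hA : A.IsGPEA) (hπ : A.IsExo π) {e f : E} (h : A.le f e) (he : π e = e) :
    π f = f := by
  obtain ⟨x, hx⟩ := h
  obtain ⟨y, hy⟩ := hπ.map_le f
  obtain ⟨z, hz⟩ := hπ.map_le x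
  obtain ⟨s, t, hs, ht, hst⟩ := hA.add_add_add_comm hy hz hx
    (hπ.perp' (hπ.idem x) (hπ.map_compl hA hy))
  have hm := hπ.map_add hx
  rw [he] at hm
  obtain rfl := hA.unique hm hs
  obtain rfl := hA.eq_zero_of_add_eq_self hst
  obtain ⟨rfl, -⟩ := hA.positive ht
  exact hA.eq_of_add_zero hy

theorem comm (hA : A.IsGPEA) (hπ : A.IsExo π) (hξ : A.IsExo ξ) (e : E) :
    π (ξ e) = ξ (π e) := by
  obtain ⟨x, hx⟩ := hπ.map_le e
  have h := hπ.map_add (hξ.map_add hx)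
  rw [hπ.fix_of_le hA (hξ.map_le (π e)) (hπ.idem e),
    hπ.eq_zero_of_le hA (hξ.map_le x) (hπ.map_compl hA hx)] at h
  exact (hA.eq_of_add_zero h).symm

theorem comp (hA : A.IsGPEA) (hπ : A.IsExo π) (hξ : A.IsExo ξ) : A.IsExo (π ∘ ξ) := by
  refine ⟨fun e f s h => hπ.map_add (hξ.map_add h), fun e => ?_,
    fun e => hA.le_trans (hπ.map_le _) (hξ.map_le _), fun e f he hf => ?_⟩
  · simp only [Function.comp_apply]
    rw [← hπ.comm hA hξ, hξ.idem, hπ.idem]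
  · simp only [Function.comp_apply] at he hf
    have hπe : π e = e := by rw [← he, hπ.idem]
    have hξe : ξ e = e := by rw [← he, ← hπ.comm hA hξ, hξ.idem]
    obtain ⟨y, hy⟩ := hξ.map_le f
    have hξy := hξ.map_compl hA hy
    obtain ⟨s, hs, hs'⟩ := hπ.perp hπe hf
    have hξs : ξ s = s := by
      have := hξ.map_add hs
      rw [hξe, hξ.idem] at this
      exact hA.unique this hs
    obtain ⟨t, ht, ht'⟩ := hξ.perp hξs hξy
    obtain ⟨f', hf', hst⟩ := hA.assoc_right hs ht
    obtain rfl := hA.unique hy hf'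
    obtain ⟨g, hg, hg'⟩ := hA.assoc_left hs' ht'
    obtain ⟨r, hr, hr'⟩ := hξ.perp (hξ.idem f) hξy
    obtain rfl := hA.unique hy hr
    obtain rfl := hA.unique hr' hg
    exact ⟨t, hst, hg'⟩

theorem exists_compl (hA : A.IsGPEA) (hπ : A.IsExo π) :
    ∃ ρ, A.IsExo ρ ∧ (∀ e, A.R (π e) (ρ e) e) ∧ (∀ e, ρ e = e ↔ π e = A.zero) ∧
      ∀ e, ρ e = A.zero ↔ π e = e := by
  choose ρ hρ using hπ.map_le
  have hπρ e : π (ρ e) = A.zero := hπ.map_compl hA (hρ e)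
  have hfix e : ρ e = e ↔ π e = A.zero := by
    refine ⟨fun h => h ▸ hπρ e, fun h => ?_⟩
    have := hρ e
    rw [h] at this
    exact hA.eq_of_zero_add this
  have hker e : ρ e = A.zero ↔ π e = e := by
    refine ⟨fun h => ?_, fun h => ?_⟩
    · have := hρ e
      rw [h] at this
      exact hA.eq_of_add_zero this
    · have := hρ e
      rw [h] at this
      exact hA.eq_zero_of_add_eq_self this
  refine ⟨ρ, ⟨fun e f s h => ?_, fun e => (hfix _).2 (hπρ e),
    fun e => hA.le_of_add_left (hρ e), fun e f he hf => ?_⟩, hρ, hfix, hker⟩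
  · obtain ⟨x, y, hx, hy, hxy⟩ := hA.add_add_add_comm (hρ e) (hρ f) h
      (hπ.perp' (hπ.idem f) (hπρ e))
    obtain rfl := hA.unique (hπ.map_add h) hx
    rwa [hA.cancel_left (hρ s) hxy]
  · exact hπ.perp' ((hker f).1 hf) ((hfix e).1 he)

end IsExo

/-- The map `π` belongs to the exocenter and its fixed points form the interval `E[0,c]`. -/
def Represents (A : PartialAlg E) (π : E → E) (c : E) : Prop :=
  A.IsExo π ∧ ∀ e, π e = e ↔ A.le e c

namespace Represents

variable {π : E → E} {c : E}

theorem map_self (hA : A.IsGPEA) (h : A.Represents π c) : π c = c := (h.2 c).2 (hA.le_refl c)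

theorem map_le (h : A.Represents π c) (e : E) : A.le (π e) c := (h.2 _).1 (h.1.idem e)

theorem map_eq_zero (hA : A.IsGPEA) (h : A.Represents π c) {b : E} (hb : A.Defined b c) :
    π b = A.zero := by
  obtain ⟨s, hs⟩ := hb
  have hm := h.1.map_add hs
  rw [h.map_self hA] at hm
  have := hA.le_antisymm (h.map_le s) (hA.le_of_add_left hm)
  rw [this] at hm
  exact hA.eq_zero_of_add_eq_self' hm

theorem central (hA : A.IsGPEA) (h : A.Represents π c) : A.Central c := by
  refine ⟨fun a => ?_, fun a b ha hb => h.1.perp ((h.2 a).2 ha) (h.map_eq_zero hA hb),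
    fun a b s ha hb hs => ?_, fun a b s ha hb hs => ?_⟩
  · obtain ⟨x, hx⟩ := h.1.map_le a
    obtain ⟨t, -, ht⟩ := h.1.perp (h.map_self hA) (h.1.map_compl hA hx)
    exact ⟨_, x, h.map_le a, ⟨t, ht⟩, hx⟩
  · have := h.1.map_add hs
    rw [(h.2 a).2 ha, (h.2 b).2 hb] at this
    exact (h.2 s).1 (hA.unique this hs)
  · have := h.1.map_add hs
    rw [h.map_eq_zero hA ha, h.map_eq_zero hA hb] at this
    obtain ⟨t, -, ht⟩ := h.1.perp (h.map_self hA) (hA.eq_of_zero_add this).symm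
    exact ⟨t, ht⟩

theorem comp (hA : A.IsGPEA) (h : A.Represents π c) {ξ : E → E} (hξ : A.IsExo ξ) :
    A.Represents (ξ ∘ π) (ξ c) := by
  refine ⟨hξ.comp hA h.1, fun e => ⟨fun he => ?_, fun he => ?_⟩⟩
  · rw [← he]
    exact hξ.mono (h.map_le e)
  · have h1 : π e = e := (h.2 e).2 (hA.le_trans he (hξ.map_le c))
    rw [Function.comp_apply, h1, hξ.fix_of_le hA he (hξ.idem c)]

end Represents

namespace Central

variable {c : E}

theorem eq_zero (hA : A.IsGPEA) (hc : A.Central c) {x : E} (h : A.le x c)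
    (h' : A.Defined x c) : x = A.zero := by
  obtain ⟨s, hcx, hxc⟩ := hc.2.1 c x (hA.le_refl c) h'
  have := hA.le_antisymm ⟨x, hcx⟩ (hc.2.2.1 _ _ _ h (hA.le_refl c) hxc)
  rw [← this] at hcx
  exact hA.eq_zero_of_add_eq_self hcx

theorem defined_of_le (hA : A.IsGPEA) {b b' : E} (h : A.le b' b) (hb : A.Defined b c) :
    A.Defined b' c := by
  obtain ⟨s, hs⟩ := hb
  obtain ⟨t, ht, -⟩ := hA.add_mono h (hA.le_refl c) hs
  exact ⟨t, ht⟩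

theorem decomp_unique (hA : A.IsGPEA) (hc : A.Central c) {a₁ a₂ b₁ b₂ s : E}
    (ha₁ : A.le a₁ c) (ha₂ : A.Defined a₂ c) (ha : A.R a₁ a₂ s)
    (hb₁ : A.le b₁ c) (hb₂ : A.Defined b₂ c) (hb : A.R b₁ b₂ s) : a₁ = b₁ := by
  obtain ⟨y, hy⟩ := hA.exists_left ha₁
  obtain ⟨t, ht, -⟩ := hc.2.1 c a₂ (hA.le_refl c) ha₂
  obtain ⟨s', hs', hyt⟩ := hA.assoc_right hy ht
  obtain rfl := hA.unique ha hs'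
  obtain ⟨w, hw, hwb⟩ := hA.assoc_left hb hyt
  obtain ⟨z, hz⟩ := hc.2.2.1 _ _ _ ⟨_, hy⟩ hb₁ hw
  obtain ⟨b', hb', hwb'⟩ := hA.assoc_right hz ht
  obtain rfl := hA.cancel_left hwb hwb'
  obtain rfl := hc.eq_zero hA (hA.le_of_add_left hz) (defined_of_le hA ⟨_, hb'⟩ hb₂)
  obtain rfl := hA.eq_of_add_zero hz
  exact hA.cancel_left hy hw

theorem exists_represents (hA : A.IsGPEA) (hc : A.Central c) : ∃ π, A.Represents π c := by
  choose π ρ hπ hρ h using hc.1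
  have hfix e : π e = e ↔ A.le e c := by
    refine ⟨fun he => he ▸ hπ e, fun he => ?_⟩
    exact hc.decomp_unique hA (hπ e) (hρ e) (h e) he ⟨c, hA.zero_add c⟩ (hA.add_zero e)
  refine ⟨π, ⟨fun e f s hs => ?_, fun e => (hfix _).2 (hπ e), fun e => ⟨_, h e⟩,
    fun e f he hf => ?_⟩, hfix⟩
  · obtain ⟨t, hft, htf⟩ := hc.2.1 _ _ (hπ f) (hρ e)
    obtain ⟨x, y, hx, hy, hxy⟩ := hA.add_add_add_comm (h e) (h f) hs ⟨t, htf, hft⟩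
    rwa [hc.decomp_unique hA (hπ s) (hρ s) (h s) (hc.2.2.1 _ _ _ (hπ e) (hπ f) hx)
      (hc.2.2.2 _ _ _ (hρ e) (hρ f) hy) hxy]
  · have := h f
    rw [hf] at this
    exact hc.2.1 _ _ ((hfix e).1 he) (hA.eq_of_zero_add this ▸ hρ f)

end Central

theorem listSumsTo_le (hA : A.IsGPEA) {ι : Type v} {π : ι → E → E} {e : ι → E} {x : E}
    (hπ : ∀ i, A.IsExo (π i)) (hd : ∀ i j, i ≠ j → A.exoDisjoint (π i) (π j))
    (he : ∀ i, π i (e i) = e i) (hx : ∀ i, A.le (e i) x) (l : List ι) (hl : l.Nodup) {t : E}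
    (ht : A.ListSumsTo (l.map e) t) : A.le t x ∧ ∀ j ∉ l, π j t = A.zero := by
  induction l generalizing t with
  | nil =>
    obtain rfl : t = A.zero := ht
    exact ⟨hA.zero_le x, fun j _ => (hπ j).map_zero hA⟩
  | cons i l ih =>
    obtain ⟨r, hr, hrt⟩ := ht
    obtain ⟨hil, hl⟩ := List.nodup_cons.1 hl
    obtain ⟨hrx, hrj⟩ := ih hl hr
    refine ⟨?_, fun j hj => ?_⟩
    · obtain ⟨ρ, hρ, hadd, hfix, -⟩ := (hπ i).exists_compl hA
      have h1 : A.le (e i) (π i x) := he i ▸ (hπ i).mono (hx i)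
      have h2 : A.le r (ρ x) := (hfix r).2 (hrj i hil) ▸ hρ.mono hrx
      obtain ⟨t', ht', hle⟩ := hA.add_mono h1 h2 (hadd x)
      rwa [hA.unique hrt ht']
    · rw [List.mem_cons, not_or] at hj
      have := (hπ j).map_add hrt
      rw [hrj j hj.2, ← he i, hd j i hj.1] at this
      exact (hA.eq_of_zero_add this).symm

/-- In a COGPEA, a family fixed by pairwise disjoint exocentral maps has a supremum, and
summability with all members of the family passes to the supremum. -/
theorem IsCOGPEA.exists_sup (hA : A.IsGPEA) (hCO : A.IsCOGPEA) {ι : Type u} {π : ι → E → E}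
    {e : ι → E} (hπ : ∀ i, A.IsExo (π i)) (hd : ∀ i j, i ≠ j → A.exoDisjoint (π i) (π j))
    (he : ∀ i, π i (e i) = e i) :
    ∃ s, (∀ i, A.le (e i) s) ∧ (∀ x, (∀ i, A.le (e i) x) → A.le s x) ∧
      ∀ a, ((∀ i, A.Defined a (e i)) → A.Defined a s) ∧
        ((∀ i, A.Defined (e i) a) → A.Defined s a) := by
  have hG : A.GEXOrthogonal e := ⟨π, hπ, hd, he⟩
  obtain ⟨s, hs⟩ := hCO.1 e hG
  refine ⟨s, fun i => ?_, fun x hx => hs.2.2 x ?_, hCO.2 e s hG hs⟩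
  · obtain ⟨t, ht⟩ := hs.1 {i}
    obtain ⟨z, rfl, hz⟩ := ht [i] (List.nodup_singleton i) (by simp)
    obtain rfl := hA.eq_of_add_zero hz
    exact hs.2.1 _ ⟨_, ht⟩
  · rintro t ⟨F, hF⟩
    classical
    refine (listSumsTo_le hA hπ hd he hx F.toList F.nodup_toList
      (hF _ F.nodup_toList ?_)).1
    ext i
    simp

/-- In a COGPEA, a pairwise disjoint family of central elements has a central supremum. -/
theorem IsCOGPEA.exists_central_sup (hA : A.IsGPEA) (hCO : A.IsCOGPEA) {ι : Type u}
    {π : ι → E → E} {c : ι → E} (hπ : ∀ i, A.Represents (π i) (c i))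
    (hd : ∀ i j, i ≠ j → A.exoDisjoint (π i) (π j)) :
    ∃ s, A.Central s ∧ (∀ i, A.le (c i) s) ∧ ∀ x, (∀ i, A.le (c i) x) → A.le s x := by
  have hexo i := (hπ i).1
  obtain ⟨s, hcs, hs, hdef⟩ := hCO.exists_sup hA hexo hd fun i => (hπ i).map_self hA
  have defined_of_ker {a : E} (ha : ∀ i, π i a = A.zero) : A.Defined a s :=
    (hdef a).1 fun i => by
      obtain ⟨t, -, ht⟩ := (hexo i).perp ((hπ i).map_self hA) (ha i)
      exact ⟨t, ht⟩
  have ker_of_defined {a : E} (ha : A.Defined a s) (i : ι) : π i a = A.zero := by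
    obtain ⟨t, ht⟩ := ha
    obtain ⟨r, hr, -⟩ := hA.add_mono (hA.le_refl a) (hcs i) ht
    exact (hπ i).map_eq_zero hA ⟨r, hr⟩
  have eq_zero {x : E} (hx : A.le x s) (h0 : ∀ i, π i x = A.zero) : x = A.zero := by
    obtain ⟨y, hy⟩ := hx
    have hsy : A.le s y := hs y fun i => by
      have := (hexo i).map_add hy
      rw [h0 i] at this
      have h1 := (hexo i).mono (hcs i)
      rw [(hπ i).map_self hA, ← hA.eq_of_zero_add this] at h1
      exact hA.le_trans h1 ((hexo i).map_le y)
    obtain rfl := hA.le_antisymm (hA.le_of_add_left hy) hsy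
    exact hA.eq_zero_of_add_eq_self' hy
  -- every element splits along `s`, and its part below `s` is the supremum of its components
  have decomp (a : E) : ∃ a₁ a₂, A.R a₁ a₂ a ∧ A.le a₁ s ∧ (∀ i, π i a₂ = A.zero) ∧
      (∀ x, (∀ i, A.le (π i a) x) → A.le a₁ x) ∧
      ∀ b, ((∀ i, A.Defined b (π i a)) → A.Defined b a₁) ∧
        ((∀ i, A.Defined (π i a) b) → A.Defined a₁ b) := by
    obtain ⟨a₁, h1, h2, h3⟩ := hCO.exists_sup hA hexo hd fun i => (hexo i).idem a
    obtain ⟨a₂, ha⟩ := h2 a fun i => (hexo i).map_le a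
    refine ⟨a₁, a₂, ha, h2 s fun i => hA.le_trans ((hπ i).map_le a) (hcs i), fun i => ?_, h2, h3⟩
    have hm := (hexo i).map_add ha
    have := (hexo i).mono (h1 i)
    rw [(hexo i).idem] at this
    rw [hA.le_antisymm this ⟨_, hm⟩] at hm
    exact hA.eq_zero_of_add_eq_self hm
  have below {a : E} (ha : A.le a s) : (∀ x, (∀ i, A.le (π i a) x) → A.le a x) ∧
      ∀ b, ((∀ i, A.Defined b (π i a)) → A.Defined b a) ∧
        ((∀ i, A.Defined (π i a) b) → A.Defined a b) := by
    obtain ⟨a₁, a₂, h, -, h0, h2, h3⟩ := decomp a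
    obtain rfl := eq_zero (hA.le_trans (hA.le_of_add_left h) ha) h0
    obtain rfl := hA.eq_of_add_zero h
    exact ⟨h2, h3⟩
  refine ⟨s, ⟨fun a => ?_, fun a b ha hb => ?_, fun a b t ha hb ht => ?_,
    fun a b t ha hb ht => ?_⟩, hcs, hs⟩
  · obtain ⟨a₁, a₂, h, h1, h0, -⟩ := decomp a
    exact ⟨a₁, a₂, h1, defined_of_ker h0, h⟩
  · have hb0 := ker_of_defined hb
    obtain ⟨hsup, hsum⟩ := below ha
    have hperp i := (hexo i).perp ((hexo i).idem a) (hb0 i)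
    obtain ⟨p, hp⟩ := (hsum b).1 fun i => (hperp i).imp fun _ h => h.2
    obtain ⟨q, hq⟩ := (hsum b).2 fun i => (hperp i).imp fun _ h => h.1
    obtain ⟨x, hx⟩ := hA.conj_right hq
    obtain ⟨y, hy⟩ := hA.conj_left hp
    have hax : A.le a x := hsup x fun i => by
      have h1 := (hexo i).map_add hx
      have h2 := (hexo i).map_add hq
      rw [hb0 i] at h1 h2
      rw [hA.eq_of_add_zero h2, ← hA.eq_of_zero_add h1]
      exact (hexo i).map_le x
    have hay : A.le a y := hsup y fun i => by
      have h1 := (hexo i).map_add hy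
      have h2 := (hexo i).map_add hp
      rw [hb0 i] at h1 h2
      rw [hA.eq_of_zero_add h2, ← hA.eq_of_add_zero h1]
      exact (hexo i).map_le y
    obtain ⟨p', hp', hle⟩ := hA.add_mono (hA.le_refl b) hax hx
    obtain rfl := hA.unique hp hp'
    obtain ⟨q', hq', hle'⟩ := hA.add_mono hay (hA.le_refl b) hy
    obtain rfl := hA.unique hq hq'
    obtain rfl := hA.le_antisymm hle hle'
    exact ⟨_, hq, hp⟩
  · obtain ⟨t₁, t₂, h, h1, h0, -⟩ := decomp t
    have hat : A.le a t₁ := (below ha).1 _ fun i => by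
      have h2 := (hexo i).map_add ht
      have h3 := (hexo i).map_add h
      rw [h0 i] at h3
      rw [← hA.eq_of_add_zero h3] at h2
      exact hA.le_trans ⟨_, h2⟩ ((hexo i).map_le t₁)
    obtain ⟨w, hw⟩ := hat
    obtain ⟨b', hb', hab⟩ := hA.assoc_right hw h
    obtain rfl := hA.cancel_left ht hab
    obtain rfl := eq_zero (hA.le_trans (hA.le_of_add_left hb') hb) h0
    rwa [← hA.eq_of_add_zero h]
  · refine defined_of_ker fun i => ?_
    have := (hexo i).map_add ht
    rw [ker_of_defined ha i, ker_of_defined hb i] at this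
    exact (hA.eq_of_zero_add this).symm

/-- In a COGPEA, every set of central elements has a supremum, and it is central. -/
theorem IsCOGPEA.exists_central_sSup (hA : A.IsGPEA) (hCO : A.IsCOGPEA) (T : Set E)
    (hT : ∀ t ∈ T, A.Central t) :
    ∃ s, A.Central s ∧ A.IsSup T s := by
  let disj (a b : E) : Prop := ∀ x, A.le x a → A.le x b → x = A.zero
  have disj_symm : Std.Symm disj := ⟨fun a b h x hx hy => h x hy hx⟩
  obtain ⟨D, hD⟩ := zorn_subset
    {D : Set E | D ⊆ {d | A.Central d ∧ ∃ t ∈ T, A.le d t} ∧ D.Pairwise disj} (by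
      intro C hC hchain
      refine ⟨⋃₀ C, ⟨Set.sUnion_subset fun D hD => (hC hD).1, ?_⟩,
        fun D hD => Set.subset_sUnion_of_mem hD⟩
      exact (Set.pairwise_sUnion hchain.directedOn).2 fun D hD => (hC hD).2)
  obtain ⟨hDsub, hDdisj⟩ := hD.prop
  choose π hπ using fun d : D => (hDsub d.2).1.exists_represents hA
  obtain ⟨v, hv, hle, hsup⟩ := hCO.exists_central_sup hA (c := fun d : D => d.1) hπ
    fun i j hij e => hDdisj i.2 j.2 (Subtype.coe_injective.ne hij) _ ((hπ i).map_le _)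
      (hA.le_trans ((hπ i).1.map_le _) ((hπ j).map_le _))
  refine ⟨v, hv, fun t ht => ?_, fun b hb => hsup b fun d => ?_⟩
  · obtain ⟨μ, hμ⟩ := hv.exists_represents hA
    obtain ⟨τ, hτ⟩ := (hT t ht).exists_represents hA
    obtain ⟨ρ, hρ, -, hfix, hker⟩ := hμ.1.exists_compl hA
    have hdisj {x : E} (hx : A.le x (ρ t)) (hxv : A.le x v) : x = A.zero := by
      rw [← (hμ.2 x).2 hxv]
      exact (hfix x).1 (hρ.fix_of_le hA hx (hρ.idem t))
    have hmem : ρ t ∈ D := by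
      refine hD.le_of_ge ⟨Set.insert_subset ⟨(hτ.comp hA hρ).central hA, t, ht, hρ.map_le t⟩ hDsub,
        Set.pairwise_insert_of_symm.2 ⟨hDdisj, fun d hd _ x hx hxd => ?_⟩⟩
        (Set.subset_insert _ D) (Set.mem_insert _ D)
      exact hdisj hx (hA.le_trans hxd (hle ⟨d, hd⟩))
    exact (hμ.2 t).1 ((hker t).1 (hdisj (hA.le_refl _) (hle ⟨_, hmem⟩)))
  · obtain ⟨-, t, ht, hdt⟩ := hDsub d.2
    exact hA.le_trans hdt (hb t ht)

end GPEApaper.PartialAlg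

/-- A partial order in which all suprema, relative pseudocomplements and complements exist
is a complete boolean algebra. -/
theorem exists_completeBooleanAlgebra {α : Type u} [PartialOrder α]
    (hsup : ∀ S : Set α, ∃ s, IsLUB S s)
    (himp : ∀ a z : α, ∃ w, ∀ x, x ≤ w ↔ ∀ y, y ≤ x → y ≤ a → y ≤ z)
    (hcompl : ∀ a : α, ∃ b, (∀ y, y ≤ a → y ≤ b → IsBot y) ∧ ∀ z, a ≤ z → b ≤ z → IsTop z) :
    ∃ B : CompleteBooleanAlgebra α, ∀ x y : α, B.le x y ↔ x ≤ y := by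
  choose sup hsup using hsup
  choose c hc hc' using hcompl
  let _ : SupSet α := ⟨sup⟩
  let _ : CompleteLattice α := completeLatticeOfSup α hsup
  let _ : DistribLattice α := DistribLattice.ofInfSupLe fun a b d => by
    obtain ⟨w, hw⟩ := himp a (a ⊓ b ⊔ a ⊓ d)
    have h : b ⊔ d ≤ w := sup_le
      ((hw b).2 fun y hy hya => (le_inf hya hy).trans le_sup_left)
      ((hw d).2 fun y hy hya => (le_inf hya hy).trans le_sup_right)
    exact (hw _).1 h _ inf_le_right inf_le_left
  exact ⟨{ (inferInstance : CompleteLattice α), (inferInstance : DistribLattice α) with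
    compl := c
    inf_compl_le_bot := fun a => hc a _ inf_le_left inf_le_right _
    top_le_sup_compl := fun a => hc' a _ le_sup_left le_sup_right _ }, fun x y => Iff.rfl⟩

open GPEApaper PartialAlg in
/-- Theorem 5.11: in a COGPEA there is a largest central element u,
Γ(E) ⊆ E[0,u], and the center Γ(E) is a complete boolean algebra
(under the order inherited from E). -/
theorem stmt_13 {E : Type u} (A : PartialAlg E) (hA : A.IsGPEA)
    (hCO : A.IsCOGPEA) :
    ∃ u : E, A.Central u ∧
      {c : E | A.Central c} ⊆ {a : E | A.le a u} ∧
      (∀ c : E, A.Central c → A.le c u) ∧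
      ∃ B : CompleteBooleanAlgebra {c : E // A.Central c}, letI := B;
        ∀ x y : {c : E // A.Central c}, x ≤ y ↔ A.le x.1 y.1 := by
  obtain ⟨u, hu, hle, -⟩ := hCO.exists_central_sSup hA {c | A.Central c} fun _ h => h
  refine ⟨u, hu, hle, hle, ?_⟩
  obtain ⟨υ, hυ⟩ := hu.exists_represents hA
  let _ : PartialOrder {c : E // A.Central c} :=
    { le x y := A.le x.1 y.1
      le_refl x := hA.le_refl x.1
      le_trans _ _ _ h h' := hA.le_trans h h'
      le_antisymm _ _ h h' := Subtype.ext (hA.le_antisymm h h') }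
  refine exists_completeBooleanAlgebra (fun S => ?_) (fun a z => ?_) fun a => ?_
  · obtain ⟨s, hs, hub, hlub⟩ := hCO.exists_central_sSup hA (Subtype.val '' S) (by
      rintro _ ⟨c, -, rfl⟩
      exact c.2)
    refine ⟨⟨s, hs⟩, fun x hx => hub _ ⟨x, hx, rfl⟩, fun b hb => hlub _ ?_⟩
    rintro _ ⟨x, hx, rfl⟩
    exact hb hx
  · obtain ⟨α, hα⟩ := a.2.exists_represents hA
    obtain ⟨ζ, hζ⟩ := z.2.exists_represents hA
    obtain ⟨ρ, hρ, -, -, hker⟩ := hζ.1.exists_compl hA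
    obtain ⟨κ, hκ, -, hfix, -⟩ := (hρ.comp hA hα.1).exists_compl hA
    refine ⟨⟨κ u, (hυ.comp hA hκ).central hA⟩, fun x => ⟨fun hx y hyx hya => ?_, fun h => ?_⟩⟩
    · have h0 := (hfix y.1).1 (hκ.fix_of_le hA (hA.le_trans hyx hx) (hκ.idem u))
      rw [Function.comp_apply, (hα.2 y.1).2 hya] at h0
      exact (hζ.2 y.1).1 ((hker y.1).1 h0)
    · obtain ⟨χ, hχ⟩ := x.2.exists_represents hA
      have h1 : A.le (α x.1) z.1 :=
        h ⟨α x.1, (hχ.comp hA hα.1).central hA⟩ (hα.1.map_le x.1) (hα.map_le x.1)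
      have h2 : κ x.1 = x.1 := (hfix x.1).2 ((hker _).2 ((hζ.2 _).2 h1))
      have h3 := hκ.mono (hle x.1 x.2)
      rwa [h2] at h3
  · obtain ⟨α, hα⟩ := a.2.exists_represents hA
    obtain ⟨ρ, hρ, hadd, hfix, -⟩ := hα.1.exists_compl hA
    refine ⟨⟨ρ u, (hυ.comp hA hρ).central hA⟩, fun y hya hy x => ?_, fun z haz hz x => ?_⟩
    · have h0 := (hfix y.1).1 (hρ.fix_of_le hA hy (hρ.idem u))
      rw [(hα.2 y.1).2 hya] at h0
      have := hA.zero_le x.1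
      rwa [← h0] at this
    · exact hA.le_trans (hle x.1 x.2)
        (z.2.2.2.1 _ _ _ (hA.le_trans (hα.map_le u) haz) hz (hadd u))
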